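/- arXiv:1910.01277 — 4 statements merged into one kernel-verified Lean document; each statement's English description precedes it below -/
import Mathlib

section
/- Let f : ℝ^d → ℝ be differentiable and l-smooth (i.e. ‖∇f(x) − ∇f(y)‖ ≤ l‖x − y‖ for all x, y) with l > 0. Let x ∈ ℝ^d, let g ∈ ℝ^d satisfy ‖g − ∇f(x)‖ ≤ ε̂ for some ε̂ ≥ 0 with ε̂ ≤ ‖g‖/4, and let 0 < η ≤ 1/l. Then f(x − η g) ≤ f(x) − (η/4)‖g‖². -/
/-- The descent lemma: a function with `l`-Lipschitz gradient lies below its quadratic upper model. -/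
theorem le_add_inner_gradient_add_sq {E : Type*} [NormedAddCommGroup E] [InnerProductSpace ℝ E]
    [CompleteSpace E] {f : E → ℝ} {l : ℝ} (hdiff : Differentiable ℝ f)
    (hsmooth : ∀ x y, ‖gradient f x - gradient f y‖ ≤ l * ‖x - y‖) (x v : E) :
    f (x + v) ≤ f x + inner ℝ (gradient f x) v + l / 2 * ‖v‖ ^ 2 := by
  have hline (t : ℝ) : HasDerivAt (fun s : ℝ => f (x + s • v))
      (inner ℝ (gradient f (x + t • v)) v) t := by
    have hpath : HasDerivAt (fun s : ℝ => x + s • v) v t := by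
      simpa using ((hasDerivAt_id t).smul_const v).const_add x
    simpa [Function.comp_def] using (hdiff (x + t • v)).hasGradientAt.hasFDerivAt.comp_hasDerivAt t hpath
  have hmodel (t : ℝ) : HasDerivAt
      (fun s : ℝ => f x + s * inner ℝ (gradient f x) v + l / 2 * ‖v‖ ^ 2 * s ^ 2)
      (inner ℝ (gradient f x) v + l * t * ‖v‖ ^ 2) t := by
    refine ((((hasDerivAt_id t).mul_const (inner ℝ (gradient f x) v)).const_add (f x)).add
      ((hasDerivAt_pow 2 t).const_mul (l / 2 * ‖v‖ ^ 2))).congr_deriv ?_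
    push_cast
    ring
  have hbound : ∀ t ∈ Set.Ico (0 : ℝ) 1, inner ℝ (gradient f (x + t • v)) v ≤
      inner ℝ (gradient f x) v + l * t * ‖v‖ ^ 2 := by
    intro t ht
    have hgrad : ‖gradient f (x + t • v) - gradient f x‖ ≤ l * (t * ‖v‖) := by
      simpa [norm_smul, abs_of_nonneg ht.1] using hsmooth (x + t • v) x
    have hinner := real_inner_le_norm (gradient f (x + t • v) - gradient f x) v
    rw [inner_sub_left] at hinner
    linarith [mul_le_mul_of_nonneg_right hgrad (norm_nonneg v)]
  have hle := image_le_of_deriv_right_le_deriv_boundary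
    (fun t _ => (hline t).continuousAt.continuousWithinAt)
    (fun t _ => (hline t).hasDerivWithinAt) (by simp)
    (fun t _ => (hmodel t).continuousAt.continuousWithinAt)
    (fun t _ => (hmodel t).hasDerivWithinAt) hbound (Set.right_mem_Icc.2 zero_le_one)
  simpa using hle

/-- one step of gradient descent using an estimate `g` of the gradient
(accurate to within `epsh ≤ ‖g‖/4`) decreases an `l`-smooth function by `(η/4)‖g‖²`. -/
theorem estimated_gradient_descent_step_decrease
    (d : ℕ) (l : ℝ) (hl : 0 < l)
    (f : EuclideanSpace ℝ (Fin d) → ℝ)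
    (hdiff : Differentiable ℝ f)
    (hsmooth : ∀ x y, ‖gradient f x - gradient f y‖ ≤ l * ‖x - y‖)
    (x g : EuclideanSpace ℝ (Fin d)) (epsh η : ℝ)
    (hepsh0 : 0 ≤ epsh) (hclose : ‖g - gradient f x‖ ≤ epsh)
    (hepshg : epsh ≤ ‖g‖ / 4) (hη0 : 0 < η) (hηl : η ≤ 1 / l) :
    f (x - η • g) ≤ f x - η / 4 * ‖g‖ ^ 2 := by
  have hdescent := le_add_inner_gradient_add_sq hdiff hsmooth x (-(η • g))
  rw [← sub_eq_add_neg, inner_neg_right, real_inner_smul_right, norm_neg, norm_smul,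
    Real.norm_of_nonneg hη0.le] at hdescent
  have hinner : 3 / 4 * ‖g‖ ^ 2 ≤ inner ℝ (gradient f x) g := by
    have herr := real_inner_le_norm (g - gradient f x) g
    rw [inner_sub_left, real_inner_self_eq_norm_sq] at herr
    linarith [mul_le_mul_of_nonneg_right (hclose.trans hepshg) (norm_nonneg g)]
  have hstep : η * l ≤ 1 := (le_div_iff₀ hl).1 hηl
  have hquad : l / 2 * (η * ‖g‖) ^ 2 ≤ η / 2 * ‖g‖ ^ 2 := by
    linarith [mul_le_mul_of_nonneg_right hstep (by positivity : 0 ≤ η / 2 * ‖g‖ ^ 2)]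
  linarith [mul_le_mul_of_nonneg_left hinner hη0.le]
end

section
/- There exist absolute constants c_max > 0 and ĉ > 3 with the following property. Let f : ℝ^d → ℝ be twice differentiable, l-smooth and ρ-Hessian Lipschitz (l, ρ > 0) with l ≥ √(ρε), let ε > 0, χ ≥ 1, 0 < c ≤ c_max, and set η = c/l, γ = √(ρε), g_thres = (√c/χ²)ε, f_thres = (c/χ³)√(ε³/ρ), 𝒯 = χ/(ηγ), r = g_thres/l. Let δ̂ = (d l/√(ρε)) e^{−χ} and assume δ̂ < 1. Let ĝ : ℝ^d → ℝ^d satisfy ‖ĝ(x) − ∇f(x)‖ ≤ ε̂ for all x, where ε̂ ≤ min{ (√(c³)/(4χ))ε, c·g_thres, ((2−√2)/2) · (c √(ε³ρ)/(χ³ l)) · (δ̂/(2√d)) · (300ĉ + 1) }. Let x̃ satisfy ‖ĝ(x̃)‖ ≤ g_thres and λ_min(∇²f(x̃)) ≤ −√(ρε), and let ‖∇f(x̃)‖ ≤ g_thres. For ξ ∈ ℝ^d define the sequence x₀(ξ) = x̃ + ξ, x_{t+1}(ξ) = x_t(ξ) − η ĝ(x_t(ξ)), and let T = ⌊𝒯/c⌋.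 Then, with respect to the uniform probability measure on the closed Euclidean ball of radius r centered at the origin in ℝ^d, the probability of the set of ξ for which f(x_T(ξ)) − f(x̃) ≤ −f_thres is at least 1 − δ̂. -/
open MeasureTheory RealInnerProductSpace

/-- The quadratic upper bound for a function with Lipschitz gradient. -/
theorem le_quadratic_of_lipschitz_gradient {E : Type*} [NormedAddCommGroup E]
    [InnerProductSpace ℝ E] [CompleteSpace E] {f : E → ℝ} {l : ℝ} (hf : Differentiable ℝ f)
    (hl : ∀ x y, ‖gradient f x - gradient f y‖ ≤ l * ‖x - y‖) (x v : E) :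
    f (x + v) ≤ f x + inner ℝ (gradient f x) v + l / 2 * ‖v‖ ^ 2 := by
  set h : ℝ → ℝ := fun t => f (x + t • v) - t * inner ℝ (gradient f x) v - l / 2 * ‖v‖ ^ 2 * t ^ 2
    with hh
  have hd : ∀ t : ℝ, HasDerivAt h (inner ℝ (gradient f (x + t • v)) v
      - inner ℝ (gradient f x) v - l / 2 * ‖v‖ ^ 2 * (2 * t)) t := by
    intro t
    have h1 : HasDerivAt (fun t : ℝ => x + t • v) v t := by
      simpa using ((hasDerivAt_id t).smul_const v).const_add x
    have h2 : HasDerivAt (fun t : ℝ => f (x + t • v)) (inner ℝ (gradient f (x + t • v)) v) t := by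
      exact ((hf (x + t • v)).hasGradientAt.hasFDerivAt).comp_hasDerivAt t h1
    have h3 := (hasDerivAt_id t).mul_const (inner ℝ (gradient f x) v)
    have h4 := (hasDerivAt_pow 2 t).const_mul (l / 2 * ‖v‖ ^ 2)
    refine ((h2.sub h3).sub h4).congr_deriv ?_
    push_cast
    ring
  have hanti : AntitoneOn h (Set.Icc 0 1) := by
    refine antitoneOn_of_deriv_nonpos (convex_Icc 0 1)
      (fun t _ => (hd t).continuousAt.continuousWithinAt)
      (fun t _ => (hd t).differentiableAt.differentiableWithinAt) ?_
    intro t ht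
    rw [interior_Icc] at ht
    rw [(hd t).deriv, ← inner_sub_left]
    have h1 := real_inner_le_norm (gradient f (x + t • v) - gradient f x) v
    have h2 := hl (x + t • v) x
    have h3 : ‖x + t • v - x‖ = t * ‖v‖ := by
      simp [norm_smul, abs_of_pos ht.1]
    rw [h3] at h2
    have := mul_le_mul_of_nonneg_right h2 (norm_nonneg v)
    nlinarith
  have := hanti (Set.left_mem_Icc.2 zero_le_one) (Set.right_mem_Icc.2 zero_le_one) zero_le_one
  simp only [hh, zero_smul, one_smul, add_zero] at this
  linarith

/-- One inexact gradient step of length `η = c / l`, with gradient error at most `e`. -/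
theorem inexact_gradient_step {E : Type*} [NormedAddCommGroup E]
    [InnerProductSpace ℝ E] [CompleteSpace E] {f : E → ℝ} {l η c e : ℝ} (hf : Differentiable ℝ f)
    (hl : ∀ x y, ‖gradient f x - gradient f y‖ ≤ l * ‖x - y‖) (hη : 0 ≤ η) (hc : l * η = c)
    (x g : E) (hg : ‖g - gradient f x‖ ≤ e) :
    f (x - η • g) ≤ f x - η / 2 * (1 - c) * ‖g‖ ^ 2 + η / 2 * e ^ 2 := by
  have h1 := le_quadratic_of_lipschitz_gradient hf hl x (-(η • g))
  rw [← sub_eq_add_neg, inner_neg_right, inner_smul_right, norm_neg, norm_smul,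
    Real.norm_of_nonneg hη] at h1
  have h2 : ‖g - gradient f x‖ ^ 2 ≤ e ^ 2 := by gcongr
  rw [norm_sub_sq_real, real_inner_comm] at h2
  have h3 : η * (‖g‖ ^ 2 - 2 * inner ℝ (gradient f x) g + ‖gradient f x‖ ^ 2) ≤ η * e ^ 2 := by
    gcongr
  have h4 : 0 ≤ η * ‖gradient f x‖ ^ 2 := by positivity
  subst hc
  nlinarith

/-- On a ball where the Hessian varies by at most `p`, the gradient is linear up to slope `p`. -/
theorem norm_gradient_sub_sub_le {E : Type*} [NormedAddCommGroup E]
    [NormedSpace ℝ E] {G : E → E} {ρ S : ℝ} (hρ : 0 ≤ ρ)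
    (hG : Differentiable ℝ G)
    (hL : ∀ x y, ‖fderiv ℝ G x - fderiv ℝ G y‖ ≤ ρ * ‖x - y‖) {z x y : E}
    (hx : ‖x - z‖ ≤ S) (hy : ‖y - z‖ ≤ S) :
    ‖G x - G y - fderiv ℝ G z (x - y)‖ ≤ ρ * S * ‖x - y‖ := by
  refine (convex_closedBall z S).norm_image_sub_le_of_norm_fderiv_le' (fun u _ => hG u)
    (fun u hu => (hL u z).trans ?_) (mem_closedBall_iff_norm.2 hy) (mem_closedBall_iff_norm.2 hx)
  gcongr
  exact mem_closedBall_iff_norm.1 hu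

theorem isSymmetric_fderiv_gradient {E : Type*} [NormedAddCommGroup E]
    [InnerProductSpace ℝ E] [CompleteSpace E] {f : E → ℝ} (hf : Differentiable ℝ f)
    (hG : Differentiable ℝ (gradient f)) (x : E) :
    (fderiv ℝ (gradient f) x : E →ₗ[ℝ] E).IsSymmetric := by
  intro u v
  have h1 : ∀ y, HasFDerivAt f (InnerProductSpace.toDual ℝ E (gradient f y)) y :=
    fun y => (hf y).hasGradientAt.hasFDerivAt
  have h2 : HasFDerivAt (fun y => InnerProductSpace.toDual ℝ E (gradient f y))
      ((InnerProductSpace.toDual ℝ E).toContinuousLinearEquiv.toContinuousLinearMap.comp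
        (fderiv ℝ (gradient f) x)) x :=
    (InnerProductSpace.toDual ℝ E).toContinuousLinearEquiv.hasFDerivAt.comp x (hG x).hasFDerivAt
  have h3 := second_derivative_symmetric h1 h2 u v
  simp at h3
  simp only [ContinuousLinearMap.coe_coe]
  rw [h3, real_inner_comm]

/-- A symmetric operator of norm at most `l` with an eigenvalue at most `-γ` has a unit
eigenvector for some eigenvalue `-γ'`, `γ ≤ γ'`, along which `1 - η H` expands the most. -/
theorem exists_dominant_eigenvector {E : Type*} [NormedAddCommGroup E]
    [InnerProductSpace ℝ E] [FiniteDimensional ℝ E] {H : E →L[ℝ] E} {l γ η μ : ℝ}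
    (hH : (H : E →ₗ[ℝ] E).IsSymmetric) (hl : ‖H‖ ≤ l) (hη : 0 ≤ η) (hηl : η * l ≤ 1)
    {e : E} (he : e ≠ 0) (hHe : H e = μ • e) (hμ : μ ≤ -γ) :
    ∃ (γ' : ℝ) (e' : E), γ ≤ γ' ∧ ‖e'‖ = 1 ∧ H e' = (-γ') • e' ∧
      ∀ v, ‖v - η • H v‖ ≤ (1 + η * γ') * ‖v‖ := by
  set n := Module.finrank ℝ E with hn
  set b := hH.eigenvectorBasis hn.symm with hb
  set ev := hH.eigenvalues hn.symm with hev
  have hbe : ∀ i, H (b i) = ev i • b i := fun i => hH.apply_eigenvectorBasis hn.symm i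
  obtain ⟨j, hj⟩ : ∃ j, b.repr e j ≠ 0 := by
    by_contra! hcon
    exact he (b.repr.map_eq_zero_iff.1 (by ext i; simpa using hcon i))
  have hmul : ∀ v i, b.repr (H v) i = ev i * b.repr v i :=
    fun v i => hH.eigenvectorBasis_apply_self_apply hn.symm v i
  have hjμ : ev j = μ := by
    have := hmul e j
    rw [hHe] at this
    simp only [map_smul, PiLp.smul_apply, smul_eq_mul] at this
    exact (mul_right_cancel₀ hj this).symm
  have : Nonempty (Fin n) := ⟨j⟩
  obtain ⟨i₀, hi₀⟩ := Finite.exists_min ev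
  refine ⟨-ev i₀, b i₀, by linarith [hi₀ j], b.norm_eq_one i₀, by rw [neg_neg]; exact hbe i₀, ?_⟩
  intro v
  have habs : ∀ i, |ev i| ≤ l := by
    intro i
    have := H.le_opNorm (b i)
    rw [hbe, norm_smul, b.norm_eq_one, mul_one, mul_one] at this
    exact this.trans hl
  have h0 : ∀ i, 0 ≤ 1 - η * ev i := by
    intro i
    have := mul_le_mul_of_nonneg_left ((le_abs_self _).trans (habs i)) hη
    linarith
  have ha : 0 ≤ 1 + η * -ev i₀ := by have := h0 i₀; linarith
  refine le_of_sq_le_sq ?_ (by positivity)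
  rw [mul_pow, ← b.repr.norm_map, ← b.repr.norm_map v, EuclideanSpace.norm_sq_eq,
    EuclideanSpace.norm_sq_eq, Finset.mul_sum]
  refine Finset.sum_le_sum fun i _ => ?_
  have : b.repr (v - η • H v) i = (1 - η * ev i) * b.repr v i := by
    simp only [map_sub, map_smul, PiLp.sub_apply, PiLp.smul_apply, smul_eq_mul, hmul]
    ring
  rw [this, norm_mul, mul_pow]
  gcongr
  rw [Real.norm_of_nonneg (h0 i)]
  have := mul_le_mul_of_nonneg_left (hi₀ i) hη
  linarith

/-- A perturbed linear recursion started on a most expanding direction stays close to the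
unperturbed one. -/
theorem half_pow_le_norm_of_perturbed_recursion {E : Type*} [NormedAddCommGroup E]
    [NormedSpace ℝ E] {A : E → E} {a p q β s : ℝ} {e : E} {v : ℕ → E} {N : ℕ}
    (hA : ∀ u w, A (u + w) = A u + A w)
    (hAa : ∀ u, ‖A u‖ ≤ a * ‖u‖) (ha : 1 ≤ a) (he : ‖e‖ = 1) (hs : 0 ≤ s)
    (hAe : ∀ t : ℝ, A (t • e) = (a * t) • e) (hv0 : v 0 = s • e) (hp : 0 ≤ p)
    (hβ : 0 ≤ β) (hq : q ≤ β * (a - 1))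
    (hv : ∀ t < N, ‖v (t + 1) - A (v t)‖ ≤ p * ‖v t‖ + q)
    (hpN : 3 / 2 * p * N ≤ 1 / 4) (hβs : β ≤ s / 4) :
    a ^ N * s / 2 ≤ ‖v N‖ := by
  have hnorm : ∀ t : ℕ, ‖(a ^ t * s) • e‖ = a ^ t * s := by
    intro t
    rw [norm_smul, he, mul_one, Real.norm_of_nonneg (by positivity)]
  have hhalf : ∀ t ≤ N, 3 / 2 * p * s * t * a ^ t + β * (a ^ t - 1) ≤ a ^ t * s / 2 := by
    intro t ht
    have h1 : 3 / 2 * p * t ≤ 1 / 4 := by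
      refine le_trans ?_ hpN
      gcongr
    have h2 : (3 / 2 * p * t) * (s * a ^ t) ≤ 1 / 4 * (s * a ^ t) := by gcongr
    have h3 : β * a ^ t ≤ s / 4 * a ^ t := by gcongr
    linarith
  have key : ∀ t ≤ N, ‖v t - (a ^ t * s) • e‖ ≤ 3 / 2 * p * s * t * a ^ t + β * (a ^ t - 1) := by
    intro t
    induction t with
    | zero => intro _; simp [hv0]
    | succ t ih =>
      intro ht
      have ih := ih (by omega)
      have hh := hhalf t (by omega)
      have hvt : ‖v t‖ ≤ 3 / 2 * (a ^ t * s) := by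
        have := norm_le_norm_add_norm_sub' (v t) ((a ^ t * s) • e)
        rw [hnorm] at this
        linarith
      have hsplit : v (t + 1) - (a ^ (t + 1) * s) • e =
          (v (t + 1) - A (v t)) + A (v t - (a ^ t * s) • e) := by
        have : A (v t) = A (v t - (a ^ t * s) • e) + (a ^ (t + 1) * s) • e := by
          rw [pow_succ', mul_assoc, ← hAe, ← hA, sub_add_cancel]
        rw [this]; abel
      rw [hsplit]
      refine (norm_add_le _ _).trans ?_
      have h1 := hv t (by omega)
      have h2 := hAa (v t - (a ^ t * s) • e)
      have h3 := mul_le_mul_of_nonneg_left ih (by linarith : 0 ≤ a)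
      have h4 := mul_le_mul_of_nonneg_left hvt hp
      have h5 : a ^ t ≤ a ^ (t + 1) := pow_le_pow_right₀ ha (by omega)
      have h6 : 3 / 2 * p * s * a ^ t ≤ 3 / 2 * p * s * a ^ (t + 1) := by gcongr
      push_cast
      have e1 : a * (3 / 2 * p * s * t * a ^ t + β * (a ^ t - 1))
        = 3 / 2 * p * s * t * a ^ (t + 1) + β * (a ^ (t + 1) - a) := by ring
      rw [e1] at h3
      linarith
  have h1 := (key N le_rfl).trans (hhalf N le_rfl)
  have := norm_le_norm_add_norm_sub (v N) ((a ^ N * s) • e)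
  rw [hnorm] at this
  linarith

/-- Energy estimate along an inexact gradient descent trajectory. -/
theorem inexact_gradient_descent_le {E : Type*} [NormedAddCommGroup E]
    [InnerProductSpace ℝ E] [CompleteSpace E] {f : E → ℝ} {l η c e : ℝ} (hf : Differentiable ℝ f)
    (hl : ∀ x y, ‖gradient f x - gradient f y‖ ≤ l * ‖x - y‖) (hη : 0 ≤ η) (hc : l * η = c)
    {g : E → E} (hg : ∀ x, ‖g x - gradient f x‖ ≤ e) {x : ℕ → E}
    (hx : ∀ t, x (t + 1) = x t - η • g (x t)) (k t : ℕ) :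
    f (x (k + t)) ≤ f (x k) - η / 2 * (1 - c) * ∑ s ∈ Finset.range t, ‖g (x (k + s))‖ ^ 2
      + t * (η / 2 * e ^ 2) := by
  induction t with
  | zero => simp
  | succ t ih =>
    have h := inexact_gradient_step hf hl hη hc (x (k + t)) (g (x (k + t))) (hg _)
    rw [← add_assoc, hx, Finset.sum_range_succ]
    push_cast
    linarith

theorem norm_sub_sq_le_of_steps {E : Type*} [NormedAddCommGroup E] [NormedSpace ℝ E] {η : ℝ}
    {g : E → E} {x : ℕ → E} (hx : ∀ t, x (t + 1) = x t - η • g (x t)) (t : ℕ) :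
    ‖x t - x 0‖ ^ 2 ≤ t * (η ^ 2 * ∑ s ∈ Finset.range t, ‖g (x s)‖ ^ 2) := by
  have h1 : x t - x 0 = ∑ s ∈ Finset.range t, (x (s + 1) - x s) :=
    (Finset.sum_range_sub x t).symm
  have h2 : ∀ s, ‖x (s + 1) - x s‖ ^ 2 = η ^ 2 * ‖g (x s)‖ ^ 2 := by
    intro s
    rw [hx, sub_sub_cancel_left, norm_neg, norm_smul, mul_pow, Real.norm_eq_abs, sq_abs]
  calc ‖x t - x 0‖ ^ 2 ≤ (∑ s ∈ Finset.range t, ‖x (s + 1) - x s‖) ^ 2 := by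
        rw [h1]; gcongr; exact norm_sum_le _ _
    _ ≤ (Finset.range t).card * ∑ s ∈ Finset.range t, ‖x (s + 1) - x s‖ ^ 2 :=
        sq_sum_le_card_mul_sum_sq
    _ = _ := by simp_rw [h2, Finset.card_range, Finset.mul_sum]

/-- A trajectory whose value has not dropped by `F` after `T` steps stays close to its start. -/
theorem norm_sub_sq_le_of_not_escaped {E : Type*} [NormedAddCommGroup E]
    [InnerProductSpace ℝ E] [CompleteSpace E] {f : E → ℝ} {l η c e F f₀ : ℝ}
    (hf : Differentiable ℝ f)
    (hl : ∀ x y, ‖gradient f x - gradient f y‖ ≤ l * ‖x - y‖) (hη : 0 ≤ η) (hc : l * η = c)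
    (hc2 : c ≤ 1 / 2)
    {g : E → E} (hg : ∀ x, ‖g x - gradient f x‖ ≤ e) {x : ℕ → E}
    (hx : ∀ t, x (t + 1) = x t - η • g (x t)) {N T : ℕ} (hNT : N ≤ T) (hF : 0 ≤ F)
    (he : T * (η / 2 * e ^ 2) ≤ F / 4) (h0 : f (x 0) ≤ f₀ + 3 / 2 * F)
    (hT : f₀ - F < f (x T)) {t : ℕ} (ht : t ≤ N) :
    ‖x t - x 0‖ ^ 2 ≤ N * η * (12 * F) := by
  have h1 := inexact_gradient_descent_le hf hl hη hc hg hx 0 t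
  have h2 := inexact_gradient_descent_le hf hl hη hc hg hx t (T - t)
  rw [Nat.add_sub_cancel' (ht.trans hNT)] at h2
  simp only [zero_add] at h1
  have h3 : 0 ≤ η / 2 * (1 - c) * ∑ s ∈ Finset.range (T - t), ‖g (x (t + s))‖ ^ 2 :=
    mul_nonneg (mul_nonneg (by linarith) (by linarith)) (Finset.sum_nonneg fun _ _ => by positivity)
  have h4 : ((T - t : ℕ) : ℝ) + t = T := by
    rw [← Nat.cast_add, Nat.sub_add_cancel (ht.trans hNT)]
  have h5 : ((T - t : ℕ) : ℝ) * (η / 2 * e ^ 2) + t * (η / 2 * e ^ 2) = T * (η / 2 * e ^ 2) := by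
    rw [← h4]; ring
  set Q := ∑ s ∈ Finset.range t, ‖g (x s)‖ ^ 2 with hQ
  have hQ0 : 0 ≤ Q := Finset.sum_nonneg fun _ _ => by positivity
  have h6 : η * Q * (1 / 2) ≤ η * Q * (1 - c) := by
    gcongr
    linarith
  have h7 : η * Q ≤ 12 * F := by linarith
  calc ‖x t - x 0‖ ^ 2 ≤ t * (η ^ 2 * Q) := norm_sub_sq_le_of_steps hx t
    _ = t * η * (η * Q) := by ring
    _ ≤ N * η * (12 * F) := by gcongr

theorem Real.exp_half_le_one_add {x : ℝ} (h0 : 0 ≤ x) (h1 : x ≤ 1) :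
    Real.exp (x / 2) ≤ 1 + x := by
  have h2 := Real.add_one_le_exp (-(x / 2))
  have h3 : Real.exp (x / 2) * Real.exp (-(x / 2)) = 1 := by rw [← Real.exp_add]; simp
  have h4 := mul_le_mul_of_nonneg_left h2 (Real.exp_pos (x / 2)).le
  rw [h3] at h4
  nlinarith [Real.exp_pos (x / 2)]

/-- Exponential growth beats the polynomial factors relating separation and confinement radius. -/
theorem lt_growth_mul_separation {χ x a u s : ℝ} {N : ℕ} (hχ : 1 ≤ χ) (hx : 0 < x) (hx1 : x ≤ 1)
    (ha : 1 + x ≤ a) (hN : 40 * χ / x - 1 ≤ N) (hu : 0 < u) (hs : u * Real.exp (-χ) / χ ≤ s) :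
    46 * u < a ^ N * s / 2 := by
  have h1 : 39 * χ ≤ N * x := by
    have h2 : 40 * χ - x ≤ N * x := by
      have := mul_le_mul_of_nonneg_right hN hx.le
      rwa [sub_mul, one_mul, div_mul_cancel₀ _ hx.ne'] at this
    linarith
  have h3 : Real.exp (19 * χ) ≤ a ^ N := by
    calc Real.exp (19 * χ) ≤ Real.exp (N * (x / 2)) := Real.exp_le_exp.2 (by linarith)
      _ = Real.exp (x / 2) ^ N := Real.exp_nat_mul _ _
      _ ≤ a ^ N := by gcongr; exact (Real.exp_half_le_one_add hx.le hx1).trans ha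
  have h4 : 2 ^ 17 * χ < Real.exp (18 * χ) := by
    have e1 : (2 : ℝ) ^ 17 ≤ Real.exp (17 * χ) := by
      calc (2 : ℝ) ^ 17 ≤ Real.exp 1 ^ 17 := by
            gcongr
            linarith [Real.add_one_le_exp 1]
        _ = Real.exp 17 := by rw [← Real.exp_nat_mul]; norm_num
        _ ≤ _ := Real.exp_le_exp.2 (by linarith)
    have e2 : χ < Real.exp χ := by linarith [Real.add_one_le_exp χ]
    calc 2 ^ 17 * χ < 2 ^ 17 * Real.exp χ := by gcongr
      _ ≤ Real.exp (17 * χ) * Real.exp χ := by gcongr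
      _ = _ := by rw [← Real.exp_add]; ring_nf
  have h5 : 2 ^ 17 * u ≤ Real.exp (19 * χ) * (u * Real.exp (-χ) / χ) := by
    have : Real.exp (19 * χ) * (u * Real.exp (-χ) / χ) = u * Real.exp (18 * χ) / χ := by
      rw [show 18 * χ = 19 * χ + -χ by ring, Real.exp_add]; ring
    rw [this, le_div_iff₀ (by linarith)]
    nlinarith
  have h6 : Real.exp (19 * χ) * (u * Real.exp (-χ) / χ) ≤ a ^ N * s := by
    have : 0 ≤ a ^ N := (Real.exp_pos _).le.trans h3
    gcongr
  linarith

/-- An inexact gradient descent trajectory which starts near an almost stationary point `z` and has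
not decreased `f` by `F` at time `χ / (η γ c)` stays near `z` up to time `40 χ / (η γ)`. -/
theorem norm_sub_stationary_le_of_not_escaped {E : Type*} [NormedAddCommGroup E]
    [InnerProductSpace ℝ E] [CompleteSpace E] {f : E → ℝ} {l γ ε χ c σ η e r F : ℝ}
    (hf : Differentiable ℝ f)
    (hl : ∀ x y, ‖gradient f x - gradient f y‖ ≤ l * ‖x - y‖)
    (hγ : 0 < γ) (hε : 0 < ε) (hχ : 1 ≤ χ) (hσ0 : 0 < σ) (hσc : σ ^ 2 = c)
    (hc1 : c ≤ 1 / 40) (hγl : γ ≤ l)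
    (hη0 : 0 < η) (hlη : l * η = c) (hr : r = σ / χ ^ 2 * ε / l)
    (hF : F = c / χ ^ 3 * (ε ^ 2 / γ))
    {g : E → E} (hg : ∀ x, ‖g x - gradient f x‖ ≤ e) (hec : e ≤ c * (σ / χ ^ 2 * ε))
    {z : E} (hz : ‖gradient f z‖ ≤ σ / χ ^ 2 * ε)
    {T : ℕ} (hT : T = ⌊χ / (η * γ) / c⌋₊)
    {x : ℕ → E} (hx : ∀ t, x (t + 1) = x t - η • g (x t))
    (hx0 : ‖x 0 - z‖ ≤ r) (hxT : f z - F < f (x T)) {t : ℕ} (ht : t ≤ ⌊40 * χ / (η * γ)⌋₊) :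
    ‖x t - z‖ ≤ 23 * (σ * (ε / γ) / χ) := by
  have hc0 : 0 < c := by rw [← hσc]; positivity
  have hχ0 : 0 < χ := by linarith
  have hl0 : 0 < l := by linarith
  have hF0 : 0 < F := by rw [hF]; positivity
  have he0 : 0 ≤ e := (norm_nonneg _).trans (hg z)
  set u := σ * (ε / γ) / χ with hu
  have hu0 : 0 < u := by positivity
  set N := ⌊40 * χ / (η * γ)⌋₊ with hN
  have hN1 : (N : ℝ) ≤ 40 * χ / (η * γ) := Nat.floor_le (by positivity)
  have hT1 : (T : ℝ) ≤ χ / (η * γ) / c := by rw [hT]; exact Nat.floor_le (by positivity)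
  have hNT : N ≤ T := by
    rw [hT]
    refine Nat.floor_le_floor ?_
    rw [le_div_iff₀ hc0, mul_comm 40, mul_div_right_comm, mul_assoc]
    have h1 : 0 ≤ χ / (η * γ) := by positivity
    have h2 : χ / (η * γ) * (40 * c) ≤ χ / (η * γ) * 1 := by
      gcongr
      linarith
    linarith
  have hru : r ≤ u := by
    rw [hr, hu]
    have h1 : σ / χ ^ 2 * ε / l = σ * (ε / l) / χ ^ 2 := by ring
    rw [h1]
    have : χ ≤ χ ^ 2 := le_self_pow₀ hχ (by norm_num)
    gcongr
  have heT : T * (η / 2 * e ^ 2) ≤ F / 4 := by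
    have h1 : e ^ 2 ≤ (c * (σ / χ ^ 2 * ε)) ^ 2 := by gcongr
    have h2 : η / 2 * e ^ 2 ≤ η / 2 * (c * (σ / χ ^ 2 * ε)) ^ 2 := by gcongr
    calc T * (η / 2 * e ^ 2) ≤ χ / (η * γ) / c * (η / 2 * (c * (σ / χ ^ 2 * ε)) ^ 2) :=
          mul_le_mul hT1 h2 (by positivity) (by positivity)
      _ = σ ^ 2 * (c * (ε ^ 2 / γ) / χ ^ 3 / 2) := by field_simp
      _ = c / 2 * F := by rw [hσc, hF]; ring
      _ ≤ 1 / 4 * F := mul_le_mul_of_nonneg_right (by linarith) hF0.le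
      _ = F / 4 := by ring
  have hstart : f (x 0) ≤ f z + 3 / 2 * F := by
    have h1 := le_quadratic_of_lipschitz_gradient hf hl z (x 0 - z)
    rw [add_sub_cancel] at h1
    have h2 := real_inner_le_norm (gradient f z) (x 0 - z)
    have hr0 : 0 ≤ r := (norm_nonneg _).trans hx0
    have h3 : ‖gradient f z‖ * ‖x 0 - z‖ ≤ (σ / χ ^ 2 * ε) * r := by gcongr
    have h4 : l / 2 * ‖x 0 - z‖ ^ 2 ≤ l / 2 * r ^ 2 := by gcongr
    have h5 : (σ / χ ^ 2 * ε) * r + l / 2 * r ^ 2 = 3 / 2 * (σ ^ 2 / χ ^ 4 * (ε ^ 2 / l)) := by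
      rw [hr]; field_simp; ring
    have h6 : σ ^ 2 / χ ^ 4 * (ε ^ 2 / l) ≤ F := by
      rw [hF, hσc]
      have : χ ^ 3 ≤ χ ^ 4 := pow_le_pow_right₀ hχ (by norm_num)
      gcongr
    linarith
  have hNF : N * η * (12 * F) ≤ (22 * u) ^ 2 := by
    calc N * η * (12 * F) ≤ 40 * χ / (η * γ) * η * (12 * F) := by gcongr
      _ = 480 * u ^ 2 := by rw [hF, hu, ← hσc]; field_simp; norm_num
      _ ≤ 484 * u ^ 2 := by gcongr; norm_num
      _ = _ := by ring
  have h1 := norm_sub_sq_le_of_not_escaped hf hl hη0.le hlη (by linarith) hg hx hNT hF0.le heT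
    hstart hxT ht
  have h2 : ‖x t - x 0‖ ≤ 22 * u := le_of_sq_le_sq (h1.trans hNF) (by positivity)
  have h3 := norm_sub_le_norm_sub_add_norm_sub (x t) (x 0) z
  linarith

/-- Two inexact gradient descent trajectories started near a strict saddle point and differing
only along a dominant escape direction cannot both fail to escape, unless they start close. -/
theorem separation_le_of_not_escaped {E : Type*} [NormedAddCommGroup E]
    [InnerProductSpace ℝ E] [CompleteSpace E] {f : E → ℝ} {l ρ γ γ' ε χ c η e r w s F : ℝ}
    (hf : Differentiable ℝ f) (hG : Differentiable ℝ (gradient f))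
    (hl : ∀ x y, ‖gradient f x - gradient f y‖ ≤ l * ‖x - y‖)
    (hL : ∀ x y, ‖fderiv ℝ (gradient f) x - fderiv ℝ (gradient f) y‖ ≤ ρ * ‖x - y‖)
    (hρ : 0 < ρ) (hγ : 0 < γ) (hε : 0 < ε) (hχ : 1 ≤ χ) (hc0 : 0 < c)
    (hc1 : Real.sqrt c ≤ 1 / 10 ^ 5) (hγl : γ ≤ l) (hγε : γ ^ 2 = ρ * ε) (hγγ : γ ≤ γ')
    (hη : η = c / l) (hr : r = Real.sqrt c / χ ^ 2 * ε / l) (hF : F = c / χ ^ 3 * (ε ^ 2 / γ))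
    {g : E → E} (hg : ∀ x, ‖g x - gradient f x‖ ≤ e) (hec : e ≤ c * (Real.sqrt c / χ ^ 2 * ε))
    (hew : 2 * e / γ ≤ w / 4) (hw : Real.sqrt c * (ε / γ) * Real.exp (-χ) / χ ^ 2 ≤ w)
    {z v₁ : E} (hz : ‖gradient f z‖ ≤ Real.sqrt c / χ ^ 2 * ε) (hv : ‖v₁‖ = 1)
    (hHv : fderiv ℝ (gradient f) z v₁ = (-γ') • v₁)
    (hH : ∀ v, ‖v - η • fderiv ℝ (gradient f) z v‖ ≤ (1 + η * γ') * ‖v‖)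
    {T : ℕ} (hT : T = ⌊χ / (η * γ) / c⌋₊)
    {x y : ℕ → E} (hx : ∀ t, x (t + 1) = x t - η • g (x t))
    (hy : ∀ t, y (t + 1) = y t - η • g (y t))
    (hx0 : ‖x 0 - z‖ ≤ r) (hy0 : ‖y 0 - z‖ ≤ r) (hxy : x 0 - y 0 = s • v₁)
    (hxT : f z - F < f (x T)) (hyT : f z - F < f (y T)) : s ≤ w := by
  by_contra! hsw
  set σ := Real.sqrt c with hσ
  have hσ0 : 0 < σ := Real.sqrt_pos.2 hc0
  have hσc : σ ^ 2 = c := Real.sq_sqrt hc0.le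
  have hχ0 : 0 < χ := by linarith
  have hl0 : 0 < l := by linarith
  have hη0 : 0 < η := by rw [hη]; positivity
  have hlη : l * η = c := by rw [hη]; field_simp
  have hc2 : c ≤ 1 / 10 ^ 10 := by rw [← hσc]; nlinarith
  have he0 : 0 ≤ e := (norm_nonneg _).trans (hg z)
  have hw0 : 0 < w := lt_of_lt_of_le (by positivity) hw
  set u := σ * (ε / γ) / χ with hu
  have hu0 : 0 < u := by positivity
  have hx1 : η * γ ≤ 1 := by
    have : η * γ ≤ η * l := by gcongr
    nlinarith
  set N := ⌊40 * χ / (η * γ)⌋₊ with hN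
  have hN1 : (N : ℝ) ≤ 40 * χ / (η * γ) := Nat.floor_le (by positivity)
  have hN2 : 40 * χ / (η * γ) - 1 ≤ N := (Nat.sub_one_lt_floor _).le
  have hxl := fun t (ht : t ≤ N) => norm_sub_stationary_le_of_not_escaped hf hl hγ hε hχ hσ0 hσc
    (by linarith) hγl hη0 hlη hr hF hg hec hz hT hx hx0 hxT ht
  have hyl := fun t (ht : t ≤ N) => norm_sub_stationary_le_of_not_escaped hf hl hγ hε hχ hσ0 hσc
    (by linarith) hγl hη0 hlη hr hF hg hec hz hT hy hy0 hyT ht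
  rw [← hu] at hxl hyl
  have hρu : ρ * u = σ * γ / χ := by
    have : ε = γ ^ 2 / ρ := by rw [hγε]; field_simp
    rw [hu, this]; field_simp
  have hgrow := half_pow_le_norm_of_perturbed_recursion
    (A := fun v => v - η • fderiv ℝ (gradient f) z v)
    (a := 1 + η * γ') (p := η * (ρ * (23 * u))) (q := 2 * η * e) (β := 2 * e / γ) (s := s) (e := v₁)
    (v := fun t => x t - y t) (N := N) (fun a b => by simp only [map_add, smul_add]; abel) hH
    (by nlinarith) hv (by linarith)
    (fun t => by
      simp only [map_smul, hHv, smul_smul, ← sub_smul]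
      congr 1; ring)
    hxy (by positivity) (by positivity)
    (by
      rw [add_sub_cancel_left, div_mul_eq_mul_div, le_div_iff₀ hγ]
      have : 2 * η * e * γ ≤ 2 * η * e * γ' := by gcongr
      linarith)
    (fun t ht => by
      have h1 := norm_gradient_sub_sub_le hρ.le hG hL (hxl t ht.le) (hyl t ht.le)
      have h2 : x (t + 1) - y (t + 1) - ((x t - y t) - η • fderiv ℝ (gradient f) z (x t - y t)) =
          -(η • ((gradient f (x t) - gradient f (y t) - fderiv ℝ (gradient f) z (x t - y t)) +
            ((g (x t) - gradient f (x t)) - (g (y t) - gradient f (y t))))) := by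
        rw [hx, hy]
        module
      rw [h2, norm_neg, norm_smul, Real.norm_of_nonneg hη0.le]
      have h3 := norm_sub_le (g (x t) - gradient f (x t)) (g (y t) - gradient f (y t))
      calc _ ≤ η * (ρ * (23 * u) * ‖x t - y t‖ + (e + e)) := by
            gcongr
            refine (norm_add_le _ _).trans (add_le_add h1 (h3.trans (add_le_add (hg _) (hg _))))
        _ = _ := by ring)
    (by
      calc 3 / 2 * (η * (ρ * (23 * u))) * N = 69 / 2 * η * (ρ * u) * N := by ring
        _ ≤ 69 / 2 * η * (ρ * u) * (40 * χ / (η * γ)) := by gcongr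
        _ = 1380 * σ := by rw [hρu]; field_simp; norm_num
        _ ≤ 1 / 4 := by linarith)
    (by linarith)
  have hbig : 46 * u < (1 + η * γ') ^ N * s / 2 := by
    refine lt_growth_mul_separation hχ (by positivity : 0 < η * γ) hx1 (by gcongr) hN2 hu0
      (le_trans (le_of_eq ?_) (hw.trans hsw.le))
    rw [hu]; field_simp
  have h3 := norm_sub_le_norm_sub_add_norm_sub (x N) z (y N)
  rw [norm_sub_rev z] at h3
  have := hxl N le_rfl
  have := hyl N le_rfl
  linarith

/-- A measurable subset of a ball whose slices in direction `e` have diameter at most `w` has volume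
at most `w` times the volume of the ball one dimension lower. -/
theorem volume_le_of_slices {n : ℕ} {A : Set (EuclideanSpace ℝ (Fin (n + 1)))}
    (hA : MeasurableSet A) {e : EuclideanSpace ℝ (Fin (n + 1))} (he : ‖e‖ = 1) {w r : ℝ}
    (hAr : A ⊆ Metric.closedBall 0 r) (hs : ∀ z ∈ A, ∀ s : ℝ, 0 ≤ s → z + s • e ∈ A → s ≤ w) :
    volume A ≤ ENNReal.ofReal w *
      volume (Metric.closedBall (0 : EuclideanSpace ℝ (Fin n)) r) := by
  obtain ⟨b, hb⟩ : ∃ b : OrthonormalBasis (Fin (n + 1)) ℝ (EuclideanSpace ℝ (Fin (n + 1))),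
      b 0 = e := by
    have hv : Orthonormal ℝ (({0} : Set (Fin (n + 1))).domRestrict
        (fun _ : Fin (n + 1) => e)) := by
      constructor
      · intro i; simpa using he
      · intro i j hij
        exact absurd (Subsingleton.elim i j) hij
    obtain ⟨b, hb⟩ := hv.exists_orthonormalBasis_extension_of_card_eq (by simp)
    exact ⟨b, hb 0 rfl⟩
  set Ψ : ℝ × (Fin n → ℝ) → EuclideanSpace ℝ (Fin (n + 1)) := fun p =>
    b.repr.symm (WithLp.toLp 2 ((MeasurableEquiv.piFinSuccAbove (fun _ => ℝ) 0).symm p)) with hΨ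
  have hmp : MeasurePreserving Ψ (volume.prod volume) volume :=
    b.measurePreserving_repr_symm.comp ((PiLp.volume_preserving_toLp (Fin (n + 1))).comp
      (volume_preserving_piFinSuccAbove (fun _ : Fin (n + 1) => ℝ) 0).symm)
  have hadd : ∀ (t s : ℝ) y, Ψ (t + s, y) = Ψ (t, y) + s • e := by
    intro t s y
    have : s • e = b.repr.symm (s • b.repr e) := by simp
    rw [this, hΨ]
    simp only
    rw [← map_add]
    congr 1
    ext i
    rw [← hb, b.repr_self]
    refine Fin.cases ?_ (fun j => ?_) i
    · simp [MeasurableEquiv.piFinSuccAbove]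
    · simp [MeasurableEquiv.piFinSuccAbove]
  have hnorm : ∀ (t : ℝ) y, ‖WithLp.toLp 2 y‖ ≤ ‖Ψ (t, y)‖ := by
    intro t y
    rw [hΨ]
    simp only [LinearIsometryEquiv.norm_map]
    refine le_of_sq_le_sq ?_ (norm_nonneg _)
    rw [EuclideanSpace.norm_sq_eq, EuclideanSpace.norm_sq_eq, Fin.sum_univ_succ]
    simp [MeasurableEquiv.piFinSuccAbove]
    positivity
  rw [← hmp.measure_preimage hA.nullMeasurableSet,
    Measure.prod_apply_symm (hmp.measurable hA)]
  rw [← (PiLp.volume_preserving_toLp (Fin n)).measure_preimage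
    measurableSet_closedBall.nullMeasurableSet, ← lintegral_indicator_const
      ((PiLp.volume_preserving_toLp (Fin n)).measurable measurableSet_closedBall)]
  refine lintegral_mono fun y => ?_
  by_cases hy : y ∈ WithLp.toLp 2 ⁻¹' Metric.closedBall (0 : EuclideanSpace ℝ (Fin n)) r
  · rw [Set.indicator_of_mem hy]
    refine (Real.volume_le_diam _).trans (Metric.ediam_le ?_)
    have key : ∀ t s : ℝ, Ψ (t, y) ∈ A → Ψ (s, y) ∈ A → t ≤ s → s - t ≤ w := by
      intro t s ht hs' hts
      refine hs _ ht (s - t) (sub_nonneg.2 hts) ?_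
      rwa [← hadd, add_sub_cancel]
    intro t ht s hs'
    rw [edist_dist]
    refine ENNReal.ofReal_le_ofReal ?_
    rw [Real.dist_eq]
    rcases le_total t s with h | h
    · rw [abs_sub_comm, abs_of_nonneg (sub_nonneg.2 h)]
      exact key t s ht hs' h
    · rw [abs_of_nonneg (sub_nonneg.2 h)]
      exact key s t hs' ht h
  · rw [Set.indicator_of_notMem hy]
    have : (fun x : ℝ => (x, y)) ⁻¹' (Ψ ⁻¹' A) = ∅ := by
      ext t
      simp only [Set.mem_preimage, Set.mem_empty_iff_false, iff_false]
      intro ht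
      refine hy ?_
      have := hAr ht
      rw [mem_closedBall_zero_iff] at this
      rw [Set.mem_preimage, mem_closedBall_zero_iff]
      exact (hnorm t y).trans this
    rw [this, measure_empty]

theorem Real.Gamma_add_half_le {s : ℝ} (hs : 0 < s) :
    Real.Gamma (s + 1 / 2) ≤ Real.Gamma s * Real.sqrt s := by
  have h := Real.Gamma_mul_add_mul_le_rpow_Gamma_mul_rpow_Gamma hs (by linarith : 0 < s + 1)
    (by norm_num : (0 : ℝ) < 1 / 2) (by norm_num : (0 : ℝ) < 1 / 2) (by norm_num)
  rw [← Real.sqrt_eq_rpow, ← Real.sqrt_eq_rpow, Real.Gamma_add_one hs.ne',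
    Real.sqrt_mul hs.le] at h
  have h1 : 1 / 2 * s + 1 / 2 * (s + 1) = s + 1 / 2 := by ring
  have h2 := Real.mul_self_sqrt (Real.Gamma_pos_of_pos hs).le
  rw [h1] at h
  calc _ ≤ _ := h
    _ = (√(Real.Gamma s) * √(Real.Gamma s)) * √s := by ring
    _ = _ := by rw [h2]

/-- Comparison of the volumes of balls of the same radius in consecutive dimensions. -/
theorem volume_closedBall_le_succ (n : ℕ) {r : ℝ} (hr : 0 ≤ r) :
    ENNReal.ofReal r * volume (Metric.closedBall (0 : EuclideanSpace ℝ (Fin n)) r) ≤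
      ENNReal.ofReal (Real.sqrt ((n + 1 : ℕ) : ℝ)) *
        volume (Metric.closedBall (0 : EuclideanSpace ℝ (Fin (n + 1))) r) := by
  have hvol : volume (Metric.closedBall (0 : EuclideanSpace ℝ (Fin n)) r) =
      (.ofReal r) ^ n * .ofReal (√Real.pi ^ n / Real.Gamma (n / 2 + 1)) := by
    rcases Nat.eq_zero_or_pos n with rfl | hn
    · rw [← (PiLp.volume_preserving_toLp (Fin 0)).measure_preimage
        measurableSet_closedBall.nullMeasurableSet, volume_pi]
      have : WithLp.toLp 2 ⁻¹' Metric.closedBall (0 : EuclideanSpace ℝ (Fin 0)) r = Set.univ := by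
        ext y
        simp [Subsingleton.elim (WithLp.toLp 2 y) (0 : EuclideanSpace ℝ (Fin 0)), hr]
      rw [this]
      simp
    · have : Nonempty (Fin n) := ⟨⟨0, hn⟩⟩
      rw [EuclideanSpace.volume_closedBall, Fintype.card_fin]
  rw [hvol, EuclideanSpace.volume_closedBall, Fintype.card_fin, pow_succ']
  rw [mul_left_comm (ENNReal.ofReal √_), ← mul_assoc]
  rw [mul_assoc (ENNReal.ofReal r), ← ENNReal.ofReal_mul (Real.sqrt_nonneg _), mul_assoc]
  gcongr ENNReal.ofReal r * (_ * ENNReal.ofReal ?_)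
  have h1 := Real.Gamma_add_half_le (s := (n + 1 : ℝ) / 2 + 1 / 2) (by positivity)
  have h2 : (n + 1 : ℝ) / 2 + 1 / 2 = n / 2 + 1 := by ring
  rw [h2] at h1
  have h3 : (n : ℝ) / 2 + 1 + 1 / 2 = ((n + 1 : ℕ) : ℝ) / 2 + 1 := by push_cast; ring
  rw [h3] at h1
  have hpos : 0 < Real.Gamma ((n : ℝ) / 2 + 1) := Real.Gamma_pos_of_pos (by positivity)
  have hpos' : 0 < Real.Gamma (((n + 1 : ℕ) : ℝ) / 2 + 1) := Real.Gamma_pos_of_pos (by positivity)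
  rw [mul_div_assoc', div_le_div_iff₀ hpos hpos', pow_succ]
  have h4 : √((n : ℝ) / 2 + 1) ≤ √((n + 1 : ℕ) : ℝ) * √Real.pi := by
    rw [← Real.sqrt_mul (by positivity)]
    refine Real.sqrt_le_sqrt ?_
    have := Real.pi_gt_three
    push_cast
    nlinarith [(Nat.cast_nonneg n : (0 : ℝ) ≤ n)]
  calc √Real.pi ^ n * Real.Gamma (((n + 1 : ℕ) : ℝ) / 2 + 1)
      ≤ √Real.pi ^ n * (Real.Gamma ((n : ℝ) / 2 + 1) * √((n : ℝ) / 2 + 1)) := by gcongr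
    _ ≤ √Real.pi ^ n * (Real.Gamma ((n : ℝ) / 2 + 1) * (√((n + 1 : ℕ) : ℝ) * √Real.pi)) := by
        gcongr
    _ = _ := by ring

/-- If no two points of `Sᶜ` inside a ball of radius `r` differ by more than `δ r / √d` in the
direction `e`, then `S` has (outer) probability at least `1 - δ` in that ball. -/
theorem one_sub_le_uniform_closedBall {d : ℕ} {S : Set (EuclideanSpace ℝ (Fin d))}
    {e : EuclideanSpace ℝ (Fin d)} (he : ‖e‖ = 1) {δ r : ℝ} (hr : 0 < r) (hδ : 0 ≤ δ)
    (hS : ∀ z, ‖z‖ ≤ r → z ∉ S → ∀ s : ℝ, 0 ≤ s → ‖z + s • e‖ ≤ r → z + s • e ∉ S →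
      s ≤ r * δ / Real.sqrt d) :
    ENNReal.ofReal (1 - δ) ≤
      ((volume (Metric.closedBall (0 : EuclideanSpace ℝ (Fin d)) r))⁻¹ •
        volume.restrict (Metric.closedBall (0 : EuclideanSpace ℝ (Fin d)) r)) S := by
  obtain ⟨n, rfl⟩ : ∃ n, d = n + 1 := by
    rcases d with _ | n
    · simp [Subsingleton.elim e 0] at he
    · exact ⟨n, rfl⟩
  set B := Metric.closedBall (0 : EuclideanSpace ℝ (Fin (n + 1))) r with hB
  set V := volume B with hV
  have hV0 : V ≠ 0 := (Metric.measure_closedBall_pos volume _ hr).ne'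
  have hVt : V ≠ ⊤ := measure_closedBall_lt_top.ne
  set ν := V⁻¹ • volume.restrict B with hν
  have : IsProbabilityMeasure ν := ⟨by
    simp [hν, ← hV, ENNReal.inv_mul_cancel hV0 hVt]⟩
  rw [← measure_toMeasurable S]
  set G := toMeasurable ν S with hG
  have hGm : MeasurableSet G := measurableSet_toMeasurable _ _
  have hSG : S ⊆ G := subset_toMeasurable _ _
  have hA : volume (Gᶜ ∩ B) ≤ ENNReal.ofReal δ * V := by
    have h1 := volume_le_of_slices (A := Gᶜ ∩ B) (hGm.compl.inter measurableSet_closedBall) he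
      (w := r * δ / Real.sqrt ((n + 1 : ℕ) : ℝ)) Set.inter_subset_right (by
        intro z hz s hs hzs
        exact hS z (mem_closedBall_zero_iff.1 hz.2) (fun h => hz.1 (hSG h)) s hs
          (mem_closedBall_zero_iff.1 hzs.2) (fun h => hzs.1 (hSG h)))
    refine h1.trans ?_
    have hpos : 0 < Real.sqrt ((n + 1 : ℕ) : ℝ) := Real.sqrt_pos.2 (by positivity)
    have h2 : r * δ / Real.sqrt ((n + 1 : ℕ) : ℝ) = (δ / Real.sqrt ((n + 1 : ℕ) : ℝ)) * r := by
      ring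
    rw [h2, ENNReal.ofReal_mul (by positivity), mul_assoc]
    refine (mul_le_mul_right (volume_closedBall_le_succ n hr.le) _).trans ?_
    rw [← mul_assoc, ← ENNReal.ofReal_mul (by positivity), div_mul_cancel₀ _ hpos.ne']
  have hcompl : ν Gᶜ ≤ ENNReal.ofReal δ := by
    rw [hν, Measure.smul_apply, Measure.restrict_apply hGm.compl, smul_eq_mul]
    calc V⁻¹ * volume (Gᶜ ∩ B) ≤ V⁻¹ * (ENNReal.ofReal δ * V) := by gcongr
      _ = ENNReal.ofReal δ * (V⁻¹ * V) := by ring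
      _ = ENNReal.ofReal δ := by rw [ENNReal.inv_mul_cancel hV0 hVt, mul_one]
  have h1 : ν G = 1 - ν Gᶜ := by
    rw [← prob_compl_eq_one_sub hGm.compl, compl_compl]
  rw [h1, ENNReal.ofReal_sub _ hδ, ENNReal.ofReal_one]
  gcongr

/-- Lemma 3 of the paper: there are absolute constants `cmax > 0` and `chat > 3`
such that around a saddle point `xt` (small gradient and estimated gradient, some Hessian
eigenvalue `lam₁ ≤ −√(ρε)`), for a perturbation `ξ` drawn uniformly from the closed ball of
radius `r`, with probability at least `1 − deltah` (where `deltah = (dl/√(ρε))e^{−χ}`), running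
`T = ⌊𝒯/c⌋` estimated-gradient-descent steps from `xt + ξ` decreases `f` below
`f(xt) − f_thres`. The Hessian is encoded as `fderiv ℝ (gradient f)`. -/
theorem perturbed_estimated_gd_escapes_saddle :
    ∃ cmax chat : ℝ, 0 < cmax ∧ 3 < chat ∧
      ∀ (d : ℕ) (l ρ ε χ c epsh deltah lam₁ : ℝ)
        (f : EuclideanSpace ℝ (Fin d) → ℝ),
        0 < l → 0 < ρ → 0 < ε → 1 ≤ χ → 0 < c → c ≤ cmax →
        Real.sqrt (ρ * ε) ≤ l →
        deltah = (d : ℝ) * l / Real.sqrt (ρ * ε) * Real.exp (-χ) →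
        deltah < 1 →
        Differentiable ℝ f → Differentiable ℝ (gradient f) →
        (∀ x y, ‖gradient f x - gradient f y‖ ≤ l * ‖x - y‖) →
        (∀ x y, ‖fderiv ℝ (gradient f) x - fderiv ℝ (gradient f) y‖ ≤ ρ * ‖x - y‖) →
        ∀ η γ gthres fthres TT r : ℝ,
          η = c / l → γ = Real.sqrt (ρ * ε) →
          gthres = Real.sqrt c / χ ^ 2 * ε →
          fthres = c / χ ^ 3 * Real.sqrt (ε ^ 3 / ρ) →
          TT = χ / (η * γ) →
          r = gthres / l →
        ∀ gest : EuclideanSpace ℝ (Fin d) → EuclideanSpace ℝ (Fin d),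
          (∀ x, ‖gest x - gradient f x‖ ≤ epsh) →
          epsh ≤ min (Real.sqrt (c ^ 3) / (4 * χ) * ε)
                  (min (c * gthres)
                    ((2 - Real.sqrt 2) / 2 * (c * Real.sqrt (ε ^ 3 * ρ) / (χ ^ 3 * l))
                      * (deltah / (2 * Real.sqrt d)) * (300 * chat + 1))) →
        ∀ xt e₁ : EuclideanSpace ℝ (Fin d),
          ‖gest xt‖ ≤ gthres →
          ‖gradient f xt‖ ≤ gthres →
          ‖e₁‖ = 1 →
          fderiv ℝ (gradient f) xt e₁ = lam₁ • e₁ →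
          lam₁ ≤ -Real.sqrt (ρ * ε) →
        ∀ X : ℕ → EuclideanSpace ℝ (Fin d) → EuclideanSpace ℝ (Fin d),
          (∀ ξ, X 0 ξ = xt + ξ) →
          (∀ t ξ, X (t + 1) ξ = X t ξ - η • gest (X t ξ)) →
          ENNReal.ofReal (1 - deltah) ≤
            ((volume (Metric.closedBall (0 : EuclideanSpace ℝ (Fin d)) r))⁻¹ •
                volume.restrict (Metric.closedBall (0 : EuclideanSpace ℝ (Fin d)) r))
              {ξ : EuclideanSpace ℝ (Fin d) | f (X ⌊TT / c⌋₊ ξ) - f xt ≤ -fthres} := by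
  refine ⟨1 / 10 ^ 10, 4, by norm_num, by norm_num, ?_⟩
  intro d l ρ ε χ c epsh deltah lam₁ f hl0 hρ hε hχ hc0 hcmax hγl hδ _ hf hG hl hL
    η γ gthres fthres TT r hη hγ hgt hft hTT hr gest hg he xt e₁ _ hz he₁ hHe hlam X hX0 hX
  have hχ0 : 0 < χ := by linarith
  have hγ0 : 0 < γ := by rw [hγ]; exact Real.sqrt_pos.2 (by positivity)
  have hγε : γ ^ 2 = ρ * ε := by rw [hγ]; exact Real.sq_sqrt (by positivity)
  have hη0 : 0 < η := by rw [hη]; positivity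
  set σ := Real.sqrt c with hσ
  have hσ0 : 0 < σ := Real.sqrt_pos.2 hc0
  have hσc : σ ^ 2 = c := Real.sq_sqrt hc0.le
  have hσ1 : σ ≤ 1 / 10 ^ 5 := by
    rw [hσ]
    exact Real.sqrt_le_iff.2 ⟨by norm_num, hcmax.trans (by norm_num)⟩
  have hρe : ρ = γ ^ 2 / ε := by rw [hγε]; field_simp
  have hsq1 : Real.sqrt (ε ^ 3 / ρ) = ε ^ 2 / γ := by
    rw [← Real.sqrt_sq (by positivity : 0 ≤ ε ^ 2 / γ), hρe]
    congr 1
    field_simp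
  have hsq2 : Real.sqrt (ε ^ 3 * ρ) = ε * γ := by
    rw [← Real.sqrt_sq (by positivity : 0 ≤ ε * γ), hρe]
    congr 1
    field_simp
  rw [← hγ] at hγl hlam hδ
  rw [hsq1] at hft
  rw [hsq2] at he
  have hd : 1 ≤ d := by
    rcases d with _ | d
    · simp [Subsingleton.elim e₁ 0] at he₁
    · omega
  have hd1 : (1 : ℝ) ≤ d := by exact_mod_cast hd
  have hsd : 1 ≤ Real.sqrt d := Real.one_le_sqrt.2 hd1
  have hδ0 : 0 ≤ deltah := by rw [hδ]; positivity
  have hr0 : 0 < r := by rw [hr, hgt]; positivity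
  have hnormH : ‖fderiv ℝ (gradient f) xt‖ ≤ l := by
    have h1 : LipschitzWith l.toNNReal (gradient f) := LipschitzWith.of_dist_le_mul fun x y => by
      rw [dist_eq_norm, dist_eq_norm, Real.coe_toNNReal _ hl0.le]
      exact hl x y
    have h2 := norm_fderiv_le_of_lipschitz ℝ h1 (x₀ := xt)
    rwa [Real.coe_toNNReal _ hl0.le] at h2
  have hηl : η * l ≤ 1 := by
    rw [hη, div_mul_cancel₀ _ hl0.ne']
    exact hcmax.trans (by norm_num)
  obtain ⟨γ', v₁, hγγ, hv₁, hHv, hH⟩ := exists_dominant_eigenvector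
    (isSymmetric_fderiv_gradient hf hG xt) hnormH hη0.le hηl
    (norm_ne_zero_iff.1 (by rw [he₁]; norm_num)) hHe hlam
  have hew := he.trans ((min_le_right _ _).trans (min_le_right _ _))
  have hec := he.trans ((min_le_right _ _).trans (min_le_left _ _))
  set w := r * deltah / Real.sqrt d with hw
  have hw0 : 0 ≤ w := by positivity
  have hwlow : σ * (ε / γ) * Real.exp (-χ) / χ ^ 2 ≤ w := by
    have h1 : w = σ * (ε / γ) * Real.exp (-χ) / χ ^ 2 * Real.sqrt d := by
      have hdd : (d : ℝ) = Real.sqrt d * Real.sqrt d := (Real.mul_self_sqrt (by positivity)).symm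
      rw [hw, hδ, hr, hgt]
      nth_rewrite 1 [hdd]
      field_simp
    rw [h1]
    exact le_mul_of_one_le_right (by positivity) hsd
  have hew' : 2 * epsh / γ ≤ w / 4 := by
    have h1 : (2 - Real.sqrt 2) / 2 * (c * (ε * γ) / (χ ^ 3 * l)) *
        (deltah / (2 * Real.sqrt d)) * (300 * 4 + 1) =
        (2 - Real.sqrt 2) * ((1201 / 4) * (σ * w * γ / χ)) := by
      rw [hw, hr, hgt, ← hσc]
      field_simp
      ring
    rw [h1] at hew
    have h2 : (2 - Real.sqrt 2) * ((1201 / 4) * (σ * w * γ / χ)) ≤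
        1 * ((1201 / 4) * (σ * w * γ / χ)) := by
      have : 1 ≤ Real.sqrt 2 := Real.one_le_sqrt.2 (by norm_num)
      gcongr
      linarith
    have h3 : σ * w * γ / χ ≤ σ * w * γ := div_le_self (by positivity) hχ
    have h4 : σ * (w * γ) ≤ 1 / 10 ^ 5 * (w * γ) := by gcongr
    rw [div_le_iff₀ hγ0]
    have h5 : 0 ≤ w * γ := by positivity
    linarith
  rw [hgt] at hec hz hr
  refine one_sub_le_uniform_closedBall hv₁ hr0 hδ0 ?_
  intro ξ hξ hξS s _ hξs hξsS
  rw [Set.mem_ofPred_eq, not_le] at hξS hξsS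
  refine separation_le_of_not_escaped (x := fun t => X t (ξ + s • v₁)) (y := fun t => X t ξ)
    hf hG hl hL hρ hγ0 hε hχ hc0 hσ1 hγl hγε hγγ hη hr hft hg hec hew' hwlow hz hv₁ hHv hH
    (T := ⌊TT / c⌋₊) (by rw [hTT]) (fun t => hX t _) (fun t => hX t _) ?_ ?_ ?_ ?_ ?_
  · simpa [hX0] using hξs
  · simpa [hX0] using hξ
  · simp [hX0]
  · linarith
  · linarith
end

section
/- Let d ≥ 1, r > 0, 0 < w ≤ r, let e be a unit vector in ℝ^d, let x̃ ∈ ℝ^d, and let X be a Lebesgue-measurable subset of the closed ball of radius r centered at x̃ such that for every x ∈ X and every real s with w ≤ s ≤ r, neither x + s·e nor x − s·e belongs to X. Then the d-dimensional Lebesgue measure of X is at most 2w · V_{d−1}(r), where V_{d−1}(r) is the (d−1)-dimensional Lebesgue measure of a (d−1)-dimensional Euclidean ball of radius r. -/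
open MeasureTheory

/-- In any line direction `e`, Euclidean space splits measure-preservingly and isometrically as a
product of `ℝ` and a Euclidean space of one dimension less. -/
theorem exists_measurePreserving_line_split (n : ℕ) (e c : EuclideanSpace ℝ (Fin (n + 1)))
    (he : ‖e‖ = 1) :
    ∃ T : ℝ × EuclideanSpace ℝ (Fin n) → EuclideanSpace ℝ (Fin (n + 1)),
      MeasurePreserving T ∧ (∀ t s y, T (t + s, y) = T (t, y) + s • e) ∧
      ∀ t y, dist (T (t, y)) c ^ 2 = t ^ 2 + ‖y‖ ^ 2 := by
  obtain ⟨b, hb⟩ := Orthonormal.exists_orthonormalBasis_extension_of_card_eq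
    (𝕜 := ℝ) (E := EuclideanSpace ℝ (Fin (n + 1))) (ι := Fin (n + 1)) (by simp)
    (v := fun _ => e) (s := {0}) (by
      refine ⟨fun _ => by simpa using he, fun i j hij => (hij (Subsingleton.elim i j)).elim⟩)
  have hb0 : b 0 = e := hb 0 rfl
  refine ⟨fun p => c + b.repr.symm (WithLp.toLp 2 (Fin.cons p.1 p.2.ofLp)), ?_, ?_, ?_⟩
  · have h1 : MeasurePreserving
        (Prod.map id (WithLp.ofLp : EuclideanSpace ℝ (Fin n) → (Fin n → ℝ)))
        ((volume : Measure ℝ).prod volume) (volume.prod volume) :=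
      (MeasurePreserving.id volume).prod (PiLp.volume_preserving_ofLp (Fin n))
    have h2 := (volume_preserving_piFinSuccAbove (fun _ : Fin (n + 1) => ℝ) 0).symm
    have h3 := PiLp.volume_preserving_toLp (Fin (n + 1))
    have h4 := b.measurePreserving_repr_symm
    have h5 := measurePreserving_add_left
      (volume : Measure (EuclideanSpace ℝ (Fin (n + 1)))) c
    have h6 := h5.comp (h4.comp (h3.comp (h2.comp h1)))
    simp only [← Fin.insertNth_zero']
    exact h6
  · intro t s y
    have : (WithLp.toLp 2 (Fin.cons (t + s) y.ofLp) : EuclideanSpace ℝ (Fin (n + 1)))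
        = WithLp.toLp 2 (Fin.cons t y.ofLp) + s • EuclideanSpace.single 0 1 := by
      ext i
      refine Fin.cases ?_ (fun j => ?_) i <;> simp
    simp only [this, map_add, map_smul, b.repr_symm_single, hb0, add_assoc]
  · intro t y
    simp [dist_eq_norm, EuclideanSpace.norm_sq_eq, Fin.sum_univ_succ]

/-- A subset of `[a - r, a + r]` without two points at a distance in `[w, r]` has length at most
`2 * w`. -/
theorem volume_le_two_mul_of_forall_add_notMem {r w a : ℝ} (hw : 0 ≤ w) {S : Set ℝ}
    (hS : S ⊆ Set.Icc (a - r) (a + r))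
    (h : ∀ x ∈ S, ∀ s, w ≤ s → s ≤ r → x + s ∉ S) :
    volume S ≤ ENNReal.ofReal (2 * w) := by
  have key : ∀ l, volume (S ∩ Set.Icc l (l + r)) ≤ ENNReal.ofReal w := by
    intro l
    refine (Real.volume_le_diam _).trans (Metric.ediam_le ?_)
    have aux : ∀ x ∈ S ∩ Set.Icc l (l + r), ∀ y ∈ S ∩ Set.Icc l (l + r), y - x ≤ w := by
      rintro x ⟨hx, hx1, -⟩ y ⟨hy, -, hy2⟩
      by_contra! hlt
      exact h x hx (y - x) hlt.le (by linarith) (by simpa using hy)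
    intro x hx y hy
    rw [edist_dist, Real.dist_eq]
    exact ENNReal.ofReal_le_ofReal (abs_sub_le_iff.2 ⟨aux y hy x hx, aux x hx y hy⟩)
  have hcover : S ⊆ (S ∩ Set.Icc (a - r) (a - r + r)) ∪ (S ∩ Set.Icc a (a + r)) := by
    intro x hx
    obtain ⟨h1, h2⟩ := hS hx
    rcases le_total x a with hxa | hxa
    · exact Or.inl ⟨hx, h1, by linarith⟩
    · exact Or.inr ⟨hx, hxa, h2⟩
  calc volume S ≤ _ := (measure_mono hcover).trans (measure_union_le _ _)
    _ ≤ ENNReal.ofReal w + ENNReal.ofReal w := add_le_add (key _) (key _)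
    _ = ENNReal.ofReal (2 * w) := by rw [← ENNReal.ofReal_add hw hw, two_mul]

/-- if `X` is a measurable subset of the closed ball of radius `r` about `xt` in
`ℝ^d` such that no point of `X` can be translated by `±s·e` (for any `w ≤ s ≤ r`, `e` a unit
vector) while staying in `X`, then `vol(X) ≤ 2w · V_{d−1}(r)`, where `V_{d−1}(r)` is the
Lebesgue measure of the `(d−1)`-dimensional ball of radius `r`. -/
theorem stuck_region_volume_bound
    (d : ℕ) (hd : 1 ≤ d) (r w : ℝ) (hr : 0 < r) (hw0 : 0 < w) (hwr : w ≤ r)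
    (e xt : EuclideanSpace ℝ (Fin d)) (he : ‖e‖ = 1)
    (X : Set (EuclideanSpace ℝ (Fin d))) (hmeas : MeasurableSet X)
    (hsub : X ⊆ Metric.closedBall xt r)
    (hstuck : ∀ x ∈ X, ∀ s : ℝ, w ≤ s → s ≤ r → x + s • e ∉ X ∧ x - s • e ∉ X) :
    volume X ≤ ENNReal.ofReal (2 * w) *
      volume (Metric.closedBall (0 : EuclideanSpace ℝ (Fin (d - 1))) r) := by
  obtain ⟨n, rfl⟩ : ∃ n, d = n + 1 := ⟨d - 1, by omega⟩
  rw [Nat.add_sub_cancel]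
  obtain ⟨T, hT, hTe, hTd⟩ := exists_measurePreserving_line_split n e xt he
  have hball : ∀ t y, T (t, y) ∈ X → t ^ 2 + ‖y‖ ^ 2 ≤ r ^ 2 := by
    intro t y h
    rw [← hTd]
    exact pow_le_pow_left₀ dist_nonneg (hsub h) 2
  rw [← hT.measure_preimage hmeas.nullMeasurableSet, Measure.volume_eq_prod,
    Measure.prod_apply_symm (hT.measurable hmeas),
    ← lintegral_indicator_const Metric.isClosed_closedBall.measurableSet]
  refine lintegral_mono fun y => ?_
  by_cases hy : y ∈ Metric.closedBall (0 : EuclideanSpace ℝ (Fin n)) r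
  · rw [Set.indicator_of_mem hy]
    refine volume_le_two_mul_of_forall_add_notMem (r := r) (a := 0) hw0.le ?_ ?_
    · intro t ht
      have h : -r ≤ t ∧ t ≤ r := abs_le_of_sq_le_sq' (by nlinarith [hball t y ht, sq_nonneg ‖y‖]) hr.le
      simpa using h
    · intro t ht s hs1 hs2 hts
      exact (hstuck _ ht s hs1 hs2).1 (hTe t s y ▸ hts)
  · rw [Set.indicator_of_notMem hy, nonpos_iff_eq_zero]
    convert measure_empty (μ := (volume : Measure ℝ))
    refine Set.eq_empty_of_forall_notMem fun t ht => hy ?_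
    rw [mem_closedBall_zero_iff]
    exact abs_le_of_sq_le_sq' (by nlinarith [hball t y ht, sq_nonneg t]) hr.le |>.2
end

section
/- Let f : ℝ^d → ℝ be differentiable and l-smooth (l > 0), let 0 < c ≤ 1, η = c/l, and let G > 0. If x ∈ ℝ^d and g ∈ ℝ^d satisfy ‖g‖ ≤ G and ‖g − ∇f(x)‖ ≤ c·G, then f(x − η g) − f(x) ≤ (3/2) c η G². -/
/-- one estimated gradient descent step with step size `η = c/l`, estimated
gradient of norm at most `G` and estimation error at most `c·G`, increases `f` by at most
`(3/2)cηG²`. -/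
theorem estimated_gradient_descent_step_increase_bound
    (d : ℕ) (l c G : ℝ) (hl : 0 < l) (hc0 : 0 < c) (hc1 : c ≤ 1) (hG : 0 < G)
    (f : EuclideanSpace ℝ (Fin d) → ℝ)
    (hdiff : Differentiable ℝ f)
    (hsmooth : ∀ x y, ‖gradient f x - gradient f y‖ ≤ l * ‖x - y‖)
    (η : ℝ) (hη : η = c / l)
    (x g : EuclideanSpace ℝ (Fin d))
    (hg : ‖g‖ ≤ G) (hclose : ‖g - gradient f x‖ ≤ c * G) :
    f (x - η • g) - f x ≤ 3 / 2 * c * η * G ^ 2 := by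
  have hη0 : 0 < η := hη ▸ div_pos hc0 hl
  have hlη : l * η = c := by rw [hη]; field_simp
  have hdescent := le_add_inner_gradient_add_sq hdiff hsmooth x (-(η • g))
  rw [← sub_eq_add_neg, inner_neg_right, real_inner_smul_right, norm_neg, norm_smul,
    Real.norm_of_nonneg hη0.le, mul_pow] at hdescent
  have hsplit : inner ℝ (g - gradient f x) g = ‖g‖ ^ 2 - inner ℝ (gradient f x) g := by
    rw [inner_sub_left, real_inner_self_eq_norm_sq]
  have herror : inner ℝ (g - gradient f x) g ≤ c * G * G :=
    (real_inner_le_norm _ _).trans (by gcongr)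
  have hinner : η * -inner ℝ (gradient f x) g ≤ η * (c * G * G) :=
    mul_le_mul_of_nonneg_left (by linarith [sq_nonneg ‖g‖]) hη0.le
  have hquad : l / 2 * (η ^ 2 * ‖g‖ ^ 2) ≤ c * η / 2 * G ^ 2 := by
    calc l / 2 * (η ^ 2 * ‖g‖ ^ 2) = c * η / 2 * ‖g‖ ^ 2 := by rw [← hlη]; ring
      _ ≤ c * η / 2 * G ^ 2 := by gcongr
  linarith
end
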